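/- Let (X,G) be a G-system, 𝓕 = {f_E}_{E∈𝓕(G)} a sub-additive potential on (X,G), E ∈ 𝓕(G), and 𝓤 a finite cover of X. Then P_E(G,𝓕;𝓤) = min{ Σ_{B∈β} sup_{x∈B} e^{f_E(x)} : β ∈ 𝓟*(𝓤_E) }; in particular the infimum defining P_E(G,𝓕;𝓤) is attained at a partition in the finite set 𝓟*(𝓤_E). -/

import Mathlib

open MeasureTheory Filter Topology
open scoped Pointwise symmDiff Classical ENNReal

/-- A Følner sequence for a countable discrete group `G`: a sequence of nonempty finite
subsets `F n` of `G` such that `|gF_n △ F_n| / |F_n| → 0` for every `g ∈ G`. -/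
def FolnerSeq (G : Type*) [Group G] [DecidableEq G] (F : ℕ → Finset G) : Prop :=
  (∀ n, (F n).Nonempty) ∧
    ∀ g : G, Tendsto (fun n => (((g • F n) ∆ F n).card : ℝ) / (F n).card) atTop (𝓝 0)

/-- The family of sets `𝓥` is finer than the family `𝓦`. -/
def IsFinerFam {X : Type*} (V W : Set (Set X)) : Prop := ∀ A ∈ V, ∃ B ∈ W, A ⊆ B

/-- The cover `𝓤_E = ⋁_{g ∈ E} g⁻¹ 𝓤` associated to a finite cover `𝓤` and `E ∈ 𝓕(G)`. -/
def DynRefine (G : Type*) {X : Type*} [SMul G X] (U : Finset (Set X)) (E : Finset G) :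
    Set (Set X) :=
  {V | ∃ u : G → Set X, (∀ g ∈ E, u g ∈ U) ∧ V = ⋂ g ∈ E, (fun x => g • x) ⁻¹' u g}

/-- `P_E(G,𝓕;𝓤)`: the infimum of `Σ_{V ∈ 𝓥} sup_{x ∈ V} e^{f_E(x)}` over all finite Borel
covers `𝓥` of `X` finer than `𝓤_E`. -/
noncomputable def CoverPressure (G : Type*) {X : Type*} [SMul G X] [MeasurableSpace X]
    (f : Finset G → X → ℝ) (U : Finset (Set X)) (E : Finset G) : ℝ :=
  sInf {S : ℝ | ∃ V : Finset (Set X), (∀ A ∈ V, MeasurableSet A) ∧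
    ⋃₀ (↑V : Set (Set X)) = Set.univ ∧ IsFinerFam (↑V) (DynRefine G U E) ∧
    S = ∑ A ∈ V, ⨆ x ∈ A, Real.exp (f E x)}

/-- A finite Borel partition of `X`. -/
def IsBorelPartition {X : Type*} [MeasurableSpace X] (P : Finset (Set X)) : Prop :=
  (∀ A ∈ P, MeasurableSet A) ∧ ⋃₀ (↑P : Set (Set X)) = Set.univ ∧
    (↑P : Set (Set X)).PairwiseDisjoint id

/-- `H_μ(α) = -Σ_{A ∈ α} μ(A) log μ(A)`. -/
noncomputable def PartEnt {X : Type*} [MeasurableSpace X] (μ : Measure X)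
    (P : Finset (Set X)) : ℝ :=
  ∑ A ∈ P, Real.negMulLog (μ A).toReal

/-- `H_μ(𝓒)`: the infimum of `H_μ(α)` over finite Borel partitions `α` finer than `𝓒`. -/
noncomputable def CoverEnt {X : Type*} [MeasurableSpace X] (μ : Measure X)
    (C : Set (Set X)) : ℝ :=
  sInf {h : ℝ | ∃ P : Finset (Set X), IsBorelPartition P ∧ IsFinerFam (↑P) C ∧ h = PartEnt μ P}

/-- `μ ∈ M(X,G)`: a `G`-invariant Borel probability measure. -/
def GInvariant (G : Type*) {X : Type*} [SMul G X] [MeasurableSpace X] (μ : Measure X) : Prop :=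
  IsProbabilityMeasure μ ∧ ∀ g : G, Measure.map (fun x => g • x) μ = μ

/-- `μ ∈ M^e(X,G)`: an ergodic `G`-invariant Borel probability measure. -/
def GErgodic (G : Type*) {X : Type*} [SMul G X] [MeasurableSpace X] (μ : Measure X) : Prop :=
  GInvariant G μ ∧ ∀ s : Set X, MeasurableSet s → (∀ g : G, (fun x => g • x) ⁻¹' s = s) →
    μ s = 0 ∨ μ s = 1

/-- A sub-additive potential on `(X,G)`: a family of continuous functions satisfying
(C1) subadditivity on disjoint unions, (C2) `f_{Eg}(x) = f_E(gx)`, and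
(C3) `sup (f_E - f_{E ∪ {g}}) < ∞`. -/
def SubaddPotential (G : Type*) {X : Type*} [Group G] [DecidableEq G] [SMul G X]
    [TopologicalSpace X] (f : Finset G → X → ℝ) : Prop :=
  (∀ E : Finset G, Continuous (f E)) ∧
  (∀ (E F : Finset G) (x : X), E.Nonempty → F.Nonempty → Disjoint E F →
    f (E ∪ F) x ≤ f E x + f F x) ∧
  (∀ (E : Finset G) (g : G) (x : X), f (E.image fun a => a * g) x = f E (g • x)) ∧
  (∃ C : ℝ, ∀ (E : Finset G) (g : G) (x : X), E.Nonempty → f E x - f (insert g E) x ≤ C)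

/-- `𝓟*(𝓥)`: the set of finite Borel partitions `β` of `X` finer than the cover `𝓥` such that
each atom of `β` is a union of atoms of the partition generated by `𝓥` (equivalently, each
`B ∈ β` contains, with any point `x`, the whole `𝓥`-membership cell of `x`). -/
def PStarPart {X : Type*} [MeasurableSpace X] (V : Set (Set X)) (β : Finset (Set X)) : Prop :=
  IsBorelPartition β ∧ IsFinerFam (↑β) V ∧
    ∀ B ∈ β, ∀ x ∈ B, {y : X | ∀ A ∈ V, (y ∈ A ↔ x ∈ A)} ⊆ B

/-- The atom containing `x` of the partition generated by the family `V`. -/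
def atomOf {X : Type*} (V : Set (Set X)) (x : X) : Set X :=
  {y : X | ∀ A ∈ V, (y ∈ A ↔ x ∈ A)}

section Atoms

variable {X : Type*} {V : Set (Set X)}

lemma mem_atomOf_self (x : X) : x ∈ atomOf V x := fun _ _ => Iff.rfl

lemma atomOf_eq_of_mem {x y : X} (h : y ∈ atomOf V x) : atomOf V y = atomOf V x := by
  ext z
  exact forall₂_congr fun A hA => by rw [h A hA]

lemma finite_range_atomOf (hV : V.Finite) : (Set.range (atomOf V)).Finite := by
  refine (hV.finite_subsets.image fun T => {y : X | ∀ A ∈ V, (y ∈ A ↔ A ∈ T)}).subset ?_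
  rintro _ ⟨x, rfl⟩
  refine ⟨{A ∈ V | x ∈ A}, Set.sep_subset _ _, ?_⟩
  ext y
  exact forall₂_congr fun A hA => by simp [hA]

lemma measurableSet_atomOf [MeasurableSpace X] (hV : V.Finite)
    (hVm : ∀ A ∈ V, MeasurableSet A) (x : X) : MeasurableSet (atomOf V x) := by
  have h : atomOf V x = ⋂ A ∈ V, {y | y ∈ A ↔ x ∈ A} := by
    ext y
    simp [atomOf]
  rw [h]
  refine MeasurableSet.biInter hV.countable fun A hA => ?_
  by_cases hx : x ∈ A
  · simpa [hx] using hVm A hA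
  · simpa only [hx, iff_false] using! (hVm A hA).compl

/-- A set containing the whole atom of each of its points is the union of a set of atoms. -/
lemma exists_sUnion_atomOf_eq {B : Set X} (hB : ∀ x ∈ B, atomOf V x ⊆ B) :
    ∃ T ⊆ Set.range (atomOf V), ⋃₀ T = B := by
  refine ⟨atomOf V '' B, Set.image_subset_range _ _, ?_⟩
  ext y
  simp only [Set.sUnion_image, Set.mem_iUnion, exists_prop]
  exact ⟨fun ⟨x, hx, hy⟩ => hB x hx hy, fun hy => ⟨y, hy, mem_atomOf_self y⟩⟩

lemma measurableSet_of_atomOf_subset [MeasurableSpace X] (hV : V.Finite)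
    (hVm : ∀ A ∈ V, MeasurableSet A) {B : Set X} (hB : ∀ x ∈ B, atomOf V x ⊆ B) :
    MeasurableSet B := by
  obtain ⟨T, hT, rfl⟩ := exists_sUnion_atomOf_eq hB
  refine MeasurableSet.sUnion ((finite_range_atomOf hV).subset hT).countable fun t ht => ?_
  obtain ⟨x, rfl⟩ := hT ht
  exact measurableSet_atomOf hV hVm x

lemma finite_setOf_pStarPart [MeasurableSpace X] (hV : V.Finite) :
    {β : Finset (Set X) | PStarPart V β}.Finite := by
  have hT := (finite_range_atomOf hV).finite_subsets.image Set.sUnion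
  refine hT.toFinset.powerset.finite_toSet.subset fun β hβ => ?_
  rw [Finset.mem_coe, Finset.mem_powerset]
  intro B hB
  rw [Set.Finite.mem_toFinset]
  exact exists_sUnion_atomOf_eq (hβ.2.2 B hB)

end Atoms

section Sup

variable {X : Type*} {g : X → ℝ}

lemma le_biSup_of_mem_of_nonneg (hg : ∀ x, 0 ≤ g x) (hb : BddAbove (Set.range g)) {A : Set X}
    {x : X} (hx : x ∈ A) : g x ≤ ⨆ y ∈ A, g y := by
  obtain ⟨M, hM⟩ := hb
  have hbdd : BddAbove (Set.range fun y => ⨆ _ : y ∈ A, g y) := by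
    refine ⟨M, ?_⟩
    rintro _ ⟨y, rfl⟩
    exact Real.iSup_le (fun _ => hM ⟨y, rfl⟩) ((hg y).trans (hM ⟨y, rfl⟩))
  exact (ciSup_pos (f := fun _ : x ∈ A => g x) hx).symm.le.trans (le_ciSup hbdd x)

lemma biSup_le_of_nonneg {A : Set X} {M : ℝ} (hM : 0 ≤ M) (h : ∀ x ∈ A, g x ≤ M) :
    ⨆ x ∈ A, g x ≤ M :=
  Real.iSup_le (fun x => Real.iSup_le (h x) hM) hM

lemma biSup_nonneg_of_nonneg (hg : ∀ x, 0 ≤ g x) (A : Set X) : 0 ≤ ⨆ x ∈ A, g x :=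
  Real.iSup_nonneg fun x => Real.iSup_nonneg fun _ => hg x

/-- The supremum over a nonempty set is realised on its trace on some member of a finite cover. -/
lemma exists_mem_inter_nonempty_le_biSup (hg : ∀ x, 0 < g x) (hb : BddAbove (Set.range g))
    {W : Finset (Set X)} (hW : ⋃₀ (↑W : Set (Set X)) = Set.univ) {c : Set X}
    (hc : c.Nonempty) :
    ∃ w ∈ W, (c ∩ w).Nonempty ∧ ∀ x ∈ c, g x ≤ ⨆ y ∈ c ∩ w, g y := by
  have hcov : ∀ x, ∃ w ∈ W, x ∈ w := fun x => by
    simpa using hW.ge (Set.mem_univ x)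
  obtain ⟨x, hx⟩ := hc
  obtain ⟨w₀, hw₀, -⟩ := hcov x
  obtain ⟨w, hw, hmax⟩ := W.exists_max_image (fun w => ⨆ y ∈ c ∩ w, g y) ⟨w₀, hw₀⟩
  have hle : ∀ x ∈ c, g x ≤ ⨆ y ∈ c ∩ w, g y := fun x hx => by
    obtain ⟨w', hw', hxw'⟩ := hcov x
    exact (le_biSup_of_mem_of_nonneg (fun y => (hg y).le) hb (Set.mem_inter hx hxw')).trans (hmax w' hw')
  refine ⟨w, hw, ?_, hle⟩
  by_contra hne
  rw [Set.not_nonempty_iff_eq_empty] at hne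
  have h := (hg x).trans_le (hle x hx)
  simp [hne] at h

/-- Any finite cover finer than `V` can be replaced by a partition in `𝓟*(V)` without increasing
the sum of the suprema of `g`. -/
lemma exists_pStarPart_sum_biSup_le [MeasurableSpace X] {V : Set (Set X)} (hV : V.Finite)
    (hVm : ∀ A ∈ V, MeasurableSet A) (hg : ∀ x, 0 < g x) (hb : BddAbove (Set.range g))
    {W : Finset (Set X)} (hW : ⋃₀ (↑W : Set (Set X)) = Set.univ)
    (hWV : IsFinerFam (↑W) V) :
    ∃ β : Finset (Set X), PStarPart V β ∧
      ∑ B ∈ β, ⨆ x ∈ B, g x ≤ ∑ A ∈ W, ⨆ x ∈ A, g x := by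
  have hg0 : ∀ x, 0 ≤ g x := fun x => (hg x).le
  choose φ hφW hφne hφle using fun c : {c : Set X // c.Nonempty} =>
    exists_mem_inter_nonempty_le_biSup hg hb hW c.2
  set ψ : X → Set X := fun x => φ ⟨atomOf V x, x, mem_atomOf_self x⟩ with hψ
  have hψ_congr : ∀ {x y}, y ∈ atomOf V x → ψ y = ψ x := fun {x y} h => by
    simp only [hψ, atomOf_eq_of_mem h]
  have hsat : ∀ w, ∀ x ∈ {x | ψ x = w}, atomOf V x ⊆ {x | ψ x = w} := fun w x hx y hy =>
    (hψ_congr hy).trans hx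
  refine ⟨W.image fun w => {x | ψ x = w}, ⟨⟨?_, ?_, ?_⟩, ?_, ?_⟩, ?_⟩
  · simp only [Finset.mem_image]
    rintro _ ⟨w, -, rfl⟩
    exact measurableSet_of_atomOf_subset hV hVm (hsat w)
  · refine Set.eq_univ_of_forall fun x => ⟨{y | ψ y = ψ x}, ?_, rfl⟩
    exact Finset.mem_coe.2 (Finset.mem_image_of_mem _ (hφW _))
  · simp only [Finset.coe_image]
    rintro _ ⟨w, -, rfl⟩ _ ⟨w', -, rfl⟩ hne
    refine Set.disjoint_left.2 fun x hx hx' => hne ?_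
    have hxw : ψ x = w := hx
    have hxw' : ψ x = w' := hx'
    rw [← hxw, ← hxw']
  · simp only [Finset.coe_image]
    rintro _ ⟨w, hw, rfl⟩
    obtain ⟨A, hA, hwA⟩ := hWV w hw
    refine ⟨A, hA, fun x hx => ?_⟩
    obtain ⟨y, hy, hyw⟩ := hφne ⟨atomOf V x, x, mem_atomOf_self x⟩
    have hxw : ψ x = w := hx
    exact (hy A hA).1 (hwA (hxw ▸ hyw))
  · simp only [Finset.mem_image]
    rintro _ ⟨w, -, rfl⟩
    exact hsat w
  · refine (Finset.sum_image_le_of_nonneg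
      fun B _ => biSup_nonneg_of_nonneg hg0 B).trans ?_
    refine Finset.sum_le_sum fun w _ => ?_
    refine biSup_le_of_nonneg (biSup_nonneg_of_nonneg hg0 w) fun x hx => ?_
    have hxw : ψ x = w := hx
    refine (hφle ⟨atomOf V x, x, mem_atomOf_self x⟩ x (mem_atomOf_self x)).trans ?_
    refine biSup_le_of_nonneg (biSup_nonneg_of_nonneg hg0 w) fun y hy => ?_
    exact le_biSup_of_mem_of_nonneg hg0 hb (hxw ▸ hy.2)

end Sup

section DynRefine

variable {G X : Type*} [SMul G X] (U : Finset (Set X)) (E : Finset G)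

lemma finite_dynRefine : (DynRefine G U E).Finite := by
  have h : {u : E → Set X | ∀ e, u e ∈ (↑U : Set (Set X))}.Finite :=
    Set.Finite.pi' fun _ => U.finite_toSet
  refine (h.image fun u => ⋂ e : E, (fun x => (e : G) • x) ⁻¹' u e).subset ?_
  rintro _ ⟨u, hu, rfl⟩
  refine ⟨fun e => u e, fun e => hu e e.2, ?_⟩
  ext x
  simp

variable {U E}

lemma measurableSet_of_mem_dynRefine [MeasurableSpace X]
    (hact : ∀ g : G, Measurable fun x : X => g • x) (hU : ∀ A ∈ U, MeasurableSet A) {A : Set X}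
    (hA : A ∈ DynRefine G U E) : MeasurableSet A := by
  obtain ⟨u, hu, rfl⟩ := hA
  exact Finset.measurableSet_biInter E fun g hg => hact g (hU _ (hu g hg))

lemma sUnion_dynRefine (hU : ⋃₀ (↑U : Set (Set X)) = Set.univ) :
    ⋃₀ DynRefine G U E = Set.univ := by
  refine Set.eq_univ_of_forall fun x => ?_
  have h : ∀ g : G, ∃ A ∈ U, g • x ∈ A := fun g => by
    simpa using hU.ge (Set.mem_univ (g • x))
  choose u hu hxu using h
  exact ⟨_, ⟨u, fun g _ => hu g, rfl⟩, Set.mem_iInter₂.2 fun g _ => hxu g⟩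

end DynRefine

/-- **The infimum defining `P_E(G,𝓕;𝓤)` is attained on `𝓟*(𝓤_E)`** (Lemma 2.3).
For a `G`-system `(X,G)`, a sub-additive potential `𝓕`, `E ∈ 𝓕(G)` and a finite Borel cover
`𝓤` of `X`, `P_E(G,𝓕;𝓤) = min { Σ_{B∈β} sup_{x∈B} e^{f_E(x)} : β ∈ 𝓟*(𝓤_E) }`. -/
theorem coverPressure_eq_min_over_pstar
    {G X : Type*} [Group G] [Countable G] [DecidableEq G]
    [MetricSpace X] [CompactSpace X] [MeasurableSpace X] [BorelSpace X]
    [MulAction G X] (hact : ∀ g : G, Continuous fun x : X => g • x)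
    (f : Finset G → X → ℝ) (hf : SubaddPotential G f)
    (U : Finset (Set X)) (hUmeas : ∀ A ∈ U, MeasurableSet A)
    (hUcover : ⋃₀ (↑U : Set (Set X)) = Set.univ)
    (E : Finset G) (hE : E.Nonempty) :
    (∃ β : Finset (Set X), PStarPart (DynRefine G U E) β ∧
      CoverPressure G f U E = ∑ B ∈ β, ⨆ x ∈ B, Real.exp (f E x)) ∧
    ∀ β : Finset (Set X), PStarPart (DynRefine G U E) β →
      CoverPressure G f U E ≤ ∑ B ∈ β, ⨆ x ∈ B, Real.exp (f E x) := by
  have hfin : (DynRefine G U E).Finite := finite_dynRefine U E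
  have hmeas : ∀ A ∈ DynRefine G U E, MeasurableSet A := fun A hA =>
    measurableSet_of_mem_dynRefine (fun g => (hact g).measurable) hUmeas hA
  have hpos : ∀ x, 0 < Real.exp (f E x) := fun x => Real.exp_pos _
  have hb : BddAbove (Set.range fun x => Real.exp (f E x)) :=
    (isCompact_range (Real.continuous_exp.comp (hf.1 E))).bddAbove
  have hle : ∀ β : Finset (Set X), PStarPart (DynRefine G U E) β →
      CoverPressure G f U E ≤ ∑ B ∈ β, ⨆ x ∈ B, Real.exp (f E x) := by
    refine fun β hβ => csInf_le ⟨0, ?_⟩ ⟨β, hβ.1.1, hβ.1.2.1, hβ.2.1, rfl⟩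
    rintro _ ⟨W, -, -, -, rfl⟩
    exact Finset.sum_nonneg fun A _ => biSup_nonneg_of_nonneg (fun x => (hpos x).le) A
  have hcov : ⋃₀ (↑hfin.toFinset : Set (Set X)) = Set.univ := by
    rw [hfin.coe_toFinset]
    exact sUnion_dynRefine hUcover
  have hfiner : IsFinerFam (↑hfin.toFinset) (DynRefine G U E) := fun A hA =>
    ⟨A, hfin.mem_toFinset.1 hA, subset_rfl⟩
  obtain ⟨β₀, hβ₀, -⟩ := exists_pStarPart_sum_biSup_le hfin hmeas hpos hb hcov hfiner
  obtain ⟨β, hβ, hmin⟩ := Set.exists_min_image _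
    (fun β : Finset (Set X) => ∑ B ∈ β, ⨆ x ∈ B, Real.exp (f E x))
    (finite_setOf_pStarPart hfin) ⟨β₀, hβ₀⟩
  refine ⟨⟨β, hβ, (hle β hβ).antisymm (le_csInf ?_ ?_)⟩, hle⟩
  · exact ⟨_, hfin.toFinset, fun A hA => hmeas A (hfin.mem_toFinset.1 hA), hcov, hfiner, rfl⟩
  · rintro _ ⟨W, -, hW, hWV, rfl⟩
    obtain ⟨β', hβ', hsum⟩ := exists_pStarPart_sum_biSup_le hfin hmeas hpos hb hW hWV
    exact (hmin β' hβ').trans hsum
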